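/- arXiv:2305.02589 — 2 statements merged into one kernel-verified Lean document; each statement's English description precedes it below -/
import Mathlib

section
/- Let 𝒳, 𝒴, 𝒵 be finite sets, p a probability mass function on 𝒳×𝒴×𝒵, and α∈(0,∞) with α≠1. Define p̂ on 𝒳×𝒴×𝒵 by p̂(x,y,z) = p(z) p(x,y|z)^α / ∑_{x',y',z'} p(z') p(x',y'|z')^α. Then H^H_α(XY|Z)_p = H^A_{1/α}(XY|Z)_{p̂}. -/
open Finset

/-- `p` is a probability mass function on a finite type. -/
def IsPMF {Ω : Type*} [Fintype Ω] (p : Ω → ℝ) : Prop :=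
  (∀ ω, 0 ≤ p ω) ∧ ∑ ω, p ω = 1

/-- Marginal distribution of the second component. -/
noncomputable def margY {X Y : Type*} [Fintype X] (p : X × Y → ℝ) (y : Y) : ℝ := ∑ x, p (x, y)

/-- Conditional distribution `p(x|y)`. -/
noncomputable def condXY {X Y : Type*} [Fintype X] (p : X × Y → ℝ) (x : X) (y : Y) : ℝ :=
  p (x, y) / margY p y

/-- Hayashi conditional Rényi entropy `H^H_α(X|Y)_p`. -/
noncomputable def HH {X Y : Type*} [Fintype X] [Fintype Y] (α : ℝ) (p : X × Y → ℝ) : ℝ :=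
  (1 / (1 - α)) * Real.log (∑ y, margY p y * ∑ x, condXY p x y ^ α)

/-- Arimoto conditional Rényi entropy `H^A_α(X|Y)_p`. -/
noncomputable def HA {X Y : Type*} [Fintype X] [Fintype Y] (α : ℝ) (p : X × Y → ℝ) : ℝ :=
  (α / (1 - α)) * Real.log (∑ y, margY p y * (∑ x, condXY p x y ^ α) ^ (1 / α))

variable {X Y Z : Type*} [Fintype X] [Fintype Y] [Fintype Z]

/-- Marginal on `Z` of a pmf on `X × Y × Z`. -/
noncomputable def margZ3 (p : X × Y × Z → ℝ) (z : Z) : ℝ := ∑ x, ∑ y, p (x, y, z)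

/-- Conditional distribution `p(x,y|z)`. -/
noncomputable def cond3 (p : X × Y × Z → ℝ) (x : X) (y : Y) (z : Z) : ℝ :=
  p (x, y, z) / margZ3 p z

/-- The tilted pmf `p̂(x,y,z) = p(z) p(x,y|z)^α / ∑ p(z') p(x',y'|z')^α`. -/
noncomputable def tilt3 (α : ℝ) (p : X × Y × Z → ℝ) : X × Y × Z → ℝ := fun (x, y, z) =>
  margZ3 p z * cond3 p x y z ^ α /
    ∑ w : X × Y × Z, margZ3 p w.2.2 * cond3 p w.1 w.2.1 w.2.2 ^ α

/-- View `(X,Y)` as the first variable and `Z` as the conditioning variable. -/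
noncomputable def jointXY_Z (p : X × Y × Z → ℝ) : (X × Y) × Z → ℝ := fun ((x, y), z) =>
  p (x, y, z)

/-- View `X` as the first variable and `(Y,Z)` as the conditioning variable. -/
noncomputable def jointX_YZ (p : X × Y × Z → ℝ) : X × (Y × Z) → ℝ := fun (x, yz) =>
  p (x, yz.1, yz.2)

/-- The tilted function `(a, b) ↦ p(b) p(a|b)^α / ∑ p(b') p(a'|b')^α`. -/
noncomputable def tilt {A B : Type*} [Fintype A] [Fintype B] (α : ℝ) (q : A × B → ℝ) :
    A × B → ℝ := fun w =>
  margY q w.2 * condXY q w.1 w.2 ^ α / ∑ b, margY q b * ∑ a, condXY q a b ^ α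

section TwoVariables

variable {A B : Type*} [Fintype A] {q : A × B → ℝ}

lemma margY_nonneg (hq : ∀ w, 0 ≤ q w) (b : B) : 0 ≤ margY q b :=
  Finset.sum_nonneg fun a _ => hq (a, b)

lemma condXY_nonneg (hq : ∀ w, 0 ≤ q w) (a : A) (b : B) : 0 ≤ condXY q a b :=
  div_nonneg (hq _) (margY_nonneg hq b)

lemma sum_condXY {b : B} (hb : margY q b ≠ 0) : ∑ a, condXY q a b = 1 := by
  simp only [condXY, ← Finset.sum_div]
  exact div_self hb

lemma sum_condXY_rpow_nonneg (hq : ∀ w, 0 ≤ q w) (α : ℝ) (b : B) :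
    0 ≤ ∑ a, condXY q a b ^ α :=
  Finset.sum_nonneg fun a _ => Real.rpow_nonneg (condXY_nonneg hq a b) α

lemma sum_condXY_rpow_pos (hq : ∀ w, 0 ≤ q w) (α : ℝ) {b : B} (hb : margY q b ≠ 0) :
    0 < ∑ a, condXY q a b ^ α := by
  obtain ⟨a, -, ha⟩ := Finset.exists_ne_zero_of_sum_ne_zero
    ((sum_condXY hb).trans_ne one_ne_zero)
  exact Finset.sum_pos' (fun a _ => Real.rpow_nonneg (condXY_nonneg hq a b) α)
    ⟨a, Finset.mem_univ a, Real.rpow_pos_of_pos ((condXY_nonneg hq a b).lt_of_ne' ha) α⟩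

variable [Fintype B]

lemma sum_margY (q : A × B → ℝ) : ∑ b, margY q b = ∑ w, q w :=
  (Fintype.sum_prod_type_right q).symm

lemma sum_margY_mul_sum_condXY_rpow_pos (hq : IsPMF q) (α : ℝ) :
    0 < ∑ b, margY q b * ∑ a, condXY q a b ^ α := by
  obtain ⟨b, -, hb⟩ := Finset.exists_ne_zero_of_sum_ne_zero
    (((sum_margY q).trans hq.2).trans_ne one_ne_zero)
  exact Finset.sum_pos'
    (fun b _ => mul_nonneg (margY_nonneg hq.1 b) (sum_condXY_rpow_nonneg hq.1 α b))
    ⟨b, Finset.mem_univ b,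
      mul_pos ((margY_nonneg hq.1 b).lt_of_ne' hb) (sum_condXY_rpow_pos hq.1 α hb)⟩

lemma margY_tilt (α : ℝ) (q : A × B → ℝ) (b : B) :
    margY (tilt α q) b =
      margY q b * (∑ a, condXY q a b ^ α) / ∑ b, margY q b * ∑ a, condXY q a b ^ α := by
  rw [margY]
  simp only [tilt]
  rw [← Finset.sum_div, ← Finset.mul_sum]

lemma condXY_tilt (hq : IsPMF q) (α : ℝ) {b : B} (hb : margY q b ≠ 0) (a : A) :
    condXY (tilt α q) a b = condXY q a b ^ α / ∑ a, condXY q a b ^ α := by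
  rw [condXY, margY_tilt, tilt,
    div_div_div_cancel_right₀ (sum_margY_mul_sum_condXY_rpow_pos hq α).ne',
    mul_div_mul_left _ _ hb]

lemma margY_tilt_mul_sum_condXY_tilt_rpow (hq : IsPMF q) {α : ℝ} (hα : α ≠ 0) (b : B) :
    margY (tilt α q) b * (∑ a, condXY (tilt α q) a b ^ (1 / α)) ^ α =
      margY q b / ∑ b, margY q b * ∑ a, condXY q a b ^ α := by
  by_cases hb : margY q b = 0
  · simp [margY_tilt, hb]
  have hS := sum_condXY_rpow_pos hq.1 α hb
  have hsum : ∑ a, condXY (tilt α q) a b ^ (1 / α) = ((∑ a, condXY q a b ^ α) ^ (1 / α))⁻¹ := by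
    have hterm (a : A) : condXY (tilt α q) a b ^ (1 / α) =
        condXY q a b / (∑ a, condXY q a b ^ α) ^ (1 / α) := by
      have hc := condXY_nonneg hq.1 a b
      rw [condXY_tilt hq α hb, Real.div_rpow (Real.rpow_nonneg hc α) hS.le, one_div,
        Real.rpow_rpow_inv hc hα]
    simp only [hterm]
    rw [← Finset.sum_div, sum_condXY hb, one_div]
  rw [hsum, Real.inv_rpow (Real.rpow_nonneg hS.le _), one_div, Real.rpow_inv_rpow hS.le hα,
    margY_tilt]
  field_simp

theorem HH_eq_HA_tilt (hq : IsPMF q) {α : ℝ} (hα0 : α ≠ 0) (hα1 : α ≠ 1) :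
    HH α q = HA (1 / α) (tilt α q) := by
  rw [HH, HA, one_div_one_div]
  simp only [margY_tilt_mul_sum_condXY_tilt_rpow hq hα0]
  rw [← Finset.sum_div, sum_margY, hq.2, one_div (∑ b, _), Real.log_inv]
  have h₁ : 1 - α ≠ 0 := sub_ne_zero.2 hα1.symm
  have h₂ : 1 / α / (1 - 1 / α) = -(1 / (1 - α)) := by
    rw [one_sub_div hα0, div_div_div_cancel_right₀ hα0, ← neg_sub 1 α, div_neg]
  rw [h₂, neg_mul_neg]

end TwoVariables

lemma margY_jointXY_Z {X Y Z : Type*} [Fintype X] [Fintype Y]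
    (p : X × Y × Z → ℝ) (z : Z) : margY (jointXY_Z p) z = margZ3 p z :=
  Fintype.sum_prod_type _

lemma condXY_jointXY_Z {X Y Z : Type*} [Fintype X] [Fintype Y]
    (p : X × Y × Z → ℝ) (x : X) (y : Y) (z : Z) :
    condXY (jointXY_Z p) (x, y) z = cond3 p x y z := by
  rw [condXY, margY_jointXY_Z, cond3, jointXY_Z]

lemma sum_jointXY_Z (p : X × Y × Z → ℝ) : ∑ w, jointXY_Z p w = ∑ w, p w :=
  Fintype.sum_equiv (Equiv.prodAssoc X Y Z) _ _ fun _ => rfl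

lemma IsPMF.jointXY_Z {p : X × Y × Z → ℝ} (hp : IsPMF p) : IsPMF (jointXY_Z p) :=
  ⟨fun _ => hp.1 _, (sum_jointXY_Z p).trans hp.2⟩

lemma jointXY_Z_tilt3 (α : ℝ) (p : X × Y × Z → ℝ) :
    jointXY_Z (tilt3 α p) = tilt α (jointXY_Z p) := by
  have hsum : ∑ w : X × Y × Z, margZ3 p w.2.2 * cond3 p w.1 w.2.1 w.2.2 ^ α =
      ∑ z, margY (jointXY_Z p) z * ∑ a, condXY (jointXY_Z p) a z ^ α := by
    rw [← sum_jointXY_Z, Fintype.sum_prod_type_right]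
    refine Finset.sum_congr rfl fun z _ => ?_
    rw [Finset.mul_sum]
    refine Finset.sum_congr rfl fun ⟨x, y⟩ _ => ?_
    rw [margY_jointXY_Z, condXY_jointXY_Z, jointXY_Z]
  funext ⟨⟨x, y⟩, z⟩
  rw [tilt, margY_jointXY_Z, condXY_jointXY_Z, ← hsum, jointXY_Z, tilt3]

/-- **Classical Rényi chain rule, joint form**:
`H^H_α(XY|Z)_p = H^A_{1/α}(XY|Z)_{p̂}`. -/
theorem renyi_chain_rule_joint (p : X × Y × Z → ℝ) (hp : IsPMF p)
    (α : ℝ) (hα0 : 0 < α) (hα1 : α ≠ 1) :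
    HH α (jointXY_Z p) = HA (1 / α) (jointXY_Z (tilt3 α p)) := by
  rw [jointXY_Z_tilt3]
  exact HH_eq_HA_tilt hp.jointXY_Z hα0.ne' hα1
end

section
/- Let p1, p2 be probability mass functions on {0,1}×𝒴1 and {0,1}×𝒴2 respectively, and let q be their combined distribution. Then for the Shannon conditional entropy, H(X_1⊕X_2|Y_1Y_2)_q + H(X_2|(X_1⊕X_2)Y_1Y_2)_q = H(X_1|Y_1)_{p_1} + H(X_2|Y_2)_{p_2}. -/
open Finset

/-- Shannon conditional entropy `H(X|Y)_p = −∑ p(x,y) log(p(x,y)/p(y))`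
(terms with `p(x,y) = 0` contribute `0` since `log 0 = 0` in Mathlib). -/
noncomputable def condEntS {X Y : Type*} [Fintype X] [Fintype Y] (p : X × Y → ℝ) : ℝ :=
  -∑ xy : X × Y, p xy * Real.log (p xy / margY p xy.2)

variable {Y1 Y2 : Type*} [Fintype Y1] [Fintype Y2]

/-- The joint distribution of `Z = X₁ ⊕ X₂` and `(Y₁, Y₂)` under the combined
distribution `q(z,x₂,y₁,y₂) = p₁(z ⊕ x₂, y₁) p₂(x₂, y₂)`. -/
noncomputable def combinedZ (p1 : ZMod 2 × Y1 → ℝ) (p2 : ZMod 2 × Y2 → ℝ) :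
    ZMod 2 × (Y1 × Y2) → ℝ := fun zy => ∑ x2 : ZMod 2, p1 (zy.1 + x2, zy.2.1) * p2 (x2, zy.2.2)

/-- The joint distribution of `X₂` and `(Z = X₁ ⊕ X₂, Y₁, Y₂)` under the combined
distribution `q(z,x₂,y₁,y₂) = p₁(z ⊕ x₂, y₁) p₂(x₂, y₂)`. -/
noncomputable def combinedX2 (p1 : ZMod 2 × Y1 → ℝ) (p2 : ZMod 2 × Y2 → ℝ) :
    ZMod 2 × (ZMod 2 × Y1 × Y2) → ℝ := fun xw =>
  p1 (xw.2.1 + xw.1, xw.2.2.1) * p2 (xw.1, xw.2.2.2)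

open Real in
theorem condEntS_eq_sum_negMulLog_sub {X Y : Type*} [Fintype X] [Fintype Y] (p : X × Y → ℝ)
    (hp : ∀ ω, 0 ≤ p ω) :
    condEntS p = ∑ ω, negMulLog (p ω) - ∑ y, negMulLog (margY p y) := by
  have hlog : ∀ ω : X × Y, p ω * log (p ω / margY p ω.2) =
      p ω * log (p ω) - p ω * log (margY p ω.2) := by
    rintro ⟨x, y⟩
    rcases (hp (x, y)).eq_or_lt with h | h
    · simp [← h]
    · have hm : 0 < margY p y :=
        h.trans_le (single_le_sum (f := fun x => p (x, y)) (fun x _ => hp (x, y)) (mem_univ x))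
      rw [log_div h.ne' hm.ne', mul_sub]
  have hmarg : ∑ ω : X × Y, p ω * log (margY p ω.2) = ∑ y, margY p y * log (margY p y) := by
    rw [Fintype.sum_prod_type_right]
    simp only [← sum_mul]
    rfl
  simp only [condEntS, hlog, sum_sub_distrib, hmarg, negMulLog, neg_mul, sum_neg_distrib]
  ring

theorem IsPMF.margY {X Y : Type*} [Fintype X] [Fintype Y] {p : X × Y → ℝ} (hp : IsPMF p) :
    IsPMF (margY p) :=
  ⟨fun y => sum_nonneg fun x _ => hp.1 (x, y), (Fintype.sum_prod_type_right p).symm.trans hp.2⟩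

open Real in
theorem IsPMF.sum_negMulLog_mul {A B : Type*} [Fintype A] [Fintype B] {f : A → ℝ} {g : B → ℝ}
    (hf : IsPMF f) (hg : IsPMF g) :
    ∑ ab : A × B, negMulLog (f ab.1 * g ab.2) = ∑ a, negMulLog (f a) + ∑ b, negMulLog (g b) := by
  simp only [Fintype.sum_prod_type, negMulLog_mul, sum_add_distrib, ← sum_mul, ← mul_sum,
    hf.2, hg.2, one_mul]

theorem margY_combinedX2 {A B : Type*} (p1 : ZMod 2 × A → ℝ) (p2 : ZMod 2 × B → ℝ) :
    margY (combinedX2 p1 p2) = combinedZ p1 p2 := rfl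

theorem margY_combinedZ {A B : Type*} (p1 : ZMod 2 × A → ℝ) (p2 : ZMod 2 × B → ℝ) (y : A × B) :
    margY (combinedZ p1 p2) y = margY p1 y.1 * margY p2 y.2 := by
  simp only [margY, combinedZ]
  rw [sum_comm, mul_sum]
  refine sum_congr rfl fun x _ => ?_
  rw [← sum_mul, ← Equiv.sum_comp (Equiv.addRight x) fun z => p1 (z, y.1)]
  rfl

theorem sum_comp_combinedX2 (φ : ℝ → ℝ) (p1 : ZMod 2 × Y1 → ℝ) (p2 : ZMod 2 × Y2 → ℝ) :
    ∑ w, φ (combinedX2 p1 p2 w) =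
      ∑ ab : (ZMod 2 × Y1) × (ZMod 2 × Y2), φ (p1 ab.1 * p2 ab.2) :=
  Fintype.sum_equiv
    { toFun := fun w => ((w.2.1 + w.1, w.2.2.1), (w.1, w.2.2.2))
      invFun := fun ab => (ab.2.1, ab.1.1 - ab.2.1, ab.1.2, ab.2.2)
      left_inv := fun w => by simp
      right_inv := fun ab => by simp } _ _ fun _ => rfl

/-- **Shannon chain rule for information combining**:
`H(X₁⊕X₂|Y₁Y₂) + H(X₂|X₁⊕X₂, Y₁Y₂) = H(X₁|Y₁) + H(X₂|Y₂)`. -/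
theorem shannon_information_combining_chain_rule
    (p1 : ZMod 2 × Y1 → ℝ) (p2 : ZMod 2 × Y2 → ℝ) (hp1 : IsPMF p1) (hp2 : IsPMF p2) :
    condEntS (combinedZ p1 p2) + condEntS (combinedX2 p1 p2) =
      condEntS p1 + condEntS p2 := by
  have hX2 : ∀ w, 0 ≤ combinedX2 p1 p2 w := fun w => mul_nonneg (hp1.1 _) (hp2.1 _)
  have hZ : ∀ w, 0 ≤ combinedZ p1 p2 w :=
    fun w => sum_nonneg fun x _ => mul_nonneg (hp1.1 _) (hp2.1 _)
  rw [condEntS_eq_sum_negMulLog_sub _ hZ, condEntS_eq_sum_negMulLog_sub _ hX2,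
    condEntS_eq_sum_negMulLog_sub _ hp1.1, condEntS_eq_sum_negMulLog_sub _ hp2.1,
    margY_combinedX2, sum_comp_combinedX2, hp1.sum_negMulLog_mul hp2]
  simp only [margY_combinedZ]
  rw [hp1.margY.sum_negMulLog_mul hp2.margY]
  ring
end
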